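/- Let G be a strongly regular graph with parameters (1911, 270, 105, 27) containing an induced quadrangle x ~ u ~ y ~ v ~ x, and let U = {u, v, w₁, w₂} be a 4-element independent set whose elements are all adjacent to x. Write c(a,b) = |N(x) ∩ N(a) ∩ N(b)|. If the sum of c(a,b) over the six unordered pairs {a,b} ⊆ U equals 155, then c(u,v) = 25, c(a,b) = 26 for the other five pairs, there is exactly one vertex z ∈ N(x) \ U with exactly 3 neighbours in U, and every other vertex of N(x) \ U has at most 2 neighbours in U. -/

import Mathlib

/-- `c(a,b) = |N(x) ∩ N(a) ∩ N(b)|`, the number of common neighbours of `x`, `a` and `b`. -/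
def commonNbrCount {V : Type*} [Fintype V] [DecidableEq V] (G : SimpleGraph V)
    [DecidableRel G.Adj] (x a b : V) : ℕ :=
  (G.neighborFinset x ∩ G.neighborFinset a ∩ G.neighborFinset b).card

section

variable {V : Type*} [Fintype V] [DecidableEq V] {G : SimpleGraph V} [DecidableRel G.Adj]

theorem commonNbrCount_comm (x a b : V) : commonNbrCount G x a b = commonNbrCount G x b a := by
  unfold commonNbrCount
  rw [Finset.inter_right_comm]

theorem commonNbrCount_self (x a : V) :
    commonNbrCount G x a a = (G.neighborFinset x ∩ G.neighborFinset a).card := by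
  unfold commonNbrCount
  rw [Finset.inter_assoc, Finset.inter_self]

theorem card_inter_neighborFinset (a b : V) :
    (G.neighborFinset a ∩ G.neighborFinset b).card = Fintype.card (G.commonNeighbors a b) := by
  rw [← Set.toFinset_card]
  congr 1
  ext z
  simp [SimpleGraph.mem_commonNeighbors]

/-- Common neighbours of non-adjacent `a`, `b` lying outside `N(x)` are not counted by `c(a,b)`. -/
theorem commonNbrCount_add_card_le {n k l m : ℕ} (h : G.IsSRGWith n k l m) {x a b : V}
    (hab : a ≠ b) (hn : ¬ G.Adj a b) (T : Finset V)
    (hT : ∀ t ∈ T, G.Adj a t ∧ G.Adj b t ∧ ¬ G.Adj x t) :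
    commonNbrCount G x a b + T.card ≤ m := by
  have hm : (G.neighborFinset a ∩ G.neighborFinset b).card = m := by
    rw [card_inter_neighborFinset]
    exact h.of_not_adj hab hn
  rw [← hm, commonNbrCount, ← Finset.card_union_of_disjoint]
  · apply Finset.card_le_card
    intro z hz
    simp only [Finset.mem_union, Finset.mem_inter, SimpleGraph.mem_neighborFinset] at hz ⊢
    rcases hz with hz | hz
    · exact ⟨hz.1.2, hz.2⟩
    · exact ⟨(hT z hz).1, (hT z hz).2.1⟩
  · rw [Finset.disjoint_left]
    intro z hz hzT
    simp only [Finset.mem_inter, SimpleGraph.mem_neighborFinset] at hz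
    exact (hT z hzT).2.2 hz.1.1

theorem sum_card_filter_adj (S U : Finset V) :
    ∑ z ∈ S, (U.filter fun p => G.Adj z p).card = ∑ a ∈ U, (S ∩ G.neighborFinset a).card := by
  refine (Finset.sum_card_bipartiteAbove_eq_sum_card_bipartiteBelow G.Adj).trans ?_
  refine Finset.sum_congr rfl fun a _ => congrArg Finset.card ?_
  ext z
  simp [Finset.bipartiteBelow, G.adj_comm]

theorem sum_sq_card_filter_adj (S U : Finset V) :
    ∑ z ∈ S, (U.filter fun p => G.Adj z p).card ^ 2 =
      ∑ a ∈ U, ∑ b ∈ U, (S ∩ G.neighborFinset a ∩ G.neighborFinset b).card := by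
  simp_rw [← sum_card_filter_adj]
  have key (z : V) : (U.filter fun p => G.Adj z p).card ^ 2 =
      ∑ a ∈ U, if z ∈ G.neighborFinset a then (U.filter fun p => G.Adj z p).card else 0 := by
    rw [← Finset.sum_filter, Finset.sum_const, smul_eq_mul, sq]
    simp [G.adj_comm]
  simp_rw [key]
  rw [Finset.sum_comm]
  refine Finset.sum_congr rfl fun a _ => ?_
  rw [← Finset.sum_filter, Finset.filter_mem_eq_inter]

end

/-- Let `G` be a strongly regular graph with parameters `(1911, 270, 105, 27)` with an induced
quadrangle `x ~ u ~ y ~ v ~ x`, and let `U = {u, v, w₁, w₂}` be a 4-element independent set of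
vertices all adjacent to `x`. If the sum of `c(a,b)` over the six unordered pairs of `U`
equals `155`, then `c(u,v) = 25`, the other five pairs have `c(a,b) = 26`, there is exactly
one vertex `z ∈ N(x) \ U` with exactly `3` neighbours in `U`, and every other vertex of
`N(x) \ U` has at most `2` neighbours in `U`. -/
theorem srg_1911_indep_four_sum_155 {V : Type*} [Fintype V] [DecidableEq V]
    (G : SimpleGraph V) [DecidableRel G.Adj] (h : G.IsSRGWith 1911 270 105 27)
    (x u y v : V)
    (hd : x ≠ u ∧ x ≠ y ∧ x ≠ v ∧ u ≠ y ∧ u ≠ v ∧ y ≠ v)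
    (hxu : G.Adj x u) (huy : G.Adj u y) (hyv : G.Adj y v) (hvx : G.Adj v x)
    (hxy : ¬ G.Adj x y) (huv : ¬ G.Adj u v)
    (w₁ w₂ : V) (U : Finset V) (hU : U = {u, v, w₁, w₂}) (hUcard : U.card = 4)
    (hUx : ∀ w ∈ U, G.Adj x w)
    (hUind : ∀ a ∈ U, ∀ b ∈ U, a ≠ b → ¬ G.Adj a b)
    (hsum : commonNbrCount G x u v + commonNbrCount G x u w₁ + commonNbrCount G x u w₂ +
        commonNbrCount G x v w₁ + commonNbrCount G x v w₂ + commonNbrCount G x w₁ w₂ = 155) :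
    commonNbrCount G x u v = 25 ∧
    commonNbrCount G x u w₁ = 26 ∧ commonNbrCount G x u w₂ = 26 ∧
    commonNbrCount G x v w₁ = 26 ∧ commonNbrCount G x v w₂ = 26 ∧
    commonNbrCount G x w₁ w₂ = 26 ∧
    ∃ z ∈ G.neighborFinset x \ U, (U.filter fun p => G.Adj z p).card = 3 ∧
      ∀ w ∈ G.neighborFinset x \ U, w ≠ z → (U.filter fun p => G.Adj w p).card ≤ 2 := by
  have hxU {a : V} (ha : a ∈ U) : G.Adj x a := hUx a ha
  have hle {a b : V} (ha : G.Adj x a) (hb : G.Adj x b) (hab : a ≠ b) (hn : ¬ G.Adj a b) :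
      commonNbrCount G x a b ≤ 26 := by
    have := commonNbrCount_add_card_le h (x := x) hab hn {x} (by simp [ha.symm, hb.symm])
    rw [Finset.card_singleton] at this
    omega
  have huv25 : commonNbrCount G x u v ≤ 25 := by
    have := commonNbrCount_add_card_le h (x := x) hd.2.2.2.2.1 huv {x, y}
      (by simp [hxu.symm, hvx, huy, hyv.symm, hxy])
    rw [Finset.card_pair hd.2.1] at this
    omega
  have hu : u ∈ U := by simp [hU]
  have hv : v ∈ U := by simp [hU]
  have hw₁ : w₁ ∈ U := by simp [hU]
  have hw₂ : w₂ ∈ U := by simp [hU]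
  have hu' : u ∉ ({v, w₁, w₂} : Finset V) := by
    intro hm
    rw [hU, Finset.insert_eq_of_mem hm] at hUcard
    exact absurd Finset.card_le_three (by rw [hUcard]; decide)
  have hv' : v ∉ ({w₁, w₂} : Finset V) := by
    intro hm
    rw [hU, Finset.insert_eq_of_mem hm] at hUcard
    exact absurd Finset.card_le_three (by rw [hUcard]; decide)
  have hw' : w₁ ≠ w₂ := by
    rintro rfl
    rw [hU, Finset.pair_eq_singleton] at hUcard
    exact absurd Finset.card_le_three (by rw [hUcard]; decide)
  have hu'' := hu'
  have hv'' := hv'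
  simp only [Finset.mem_insert, Finset.mem_singleton, not_or] at hu'' hv''
  have hleU {a b : V} (ha : a ∈ U) (hb : b ∈ U) (hab : a ≠ b) : commonNbrCount G x a b ≤ 26 :=
    hle (hxU ha) (hxU hb) hab (hUind a ha b hb hab)
  have h1 := hleU hu hw₁ hu''.2.1
  have h2 := hleU hu hw₂ hu''.2.2
  have h3 := hleU hv hw₁ hv''.1
  have h4 := hleU hv hw₂ hv''.2
  have h5 := hleU hw₁ hw₂ hw'
  refine ⟨by omega, by omega, by omega, by omega, by omega, by omega, ?_⟩
  set f : V → ℕ := fun z => (U.filter fun p => G.Adj z p).card with hf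
  set N := G.neighborFinset x with hN
  have hNcard : N.card = 270 := h.regular x
  have hUN : U ⊆ N := fun a ha => by simpa [hN] using hUx a ha
  have hdeg {a : V} (ha : G.Adj x a) : (N ∩ G.neighborFinset a).card = 105 := by
    rw [hN, card_inter_neighborFinset]
    exact h.of_adj x a ha
  have hself {a : V} (ha : a ∈ U) : commonNbrCount G x a a = 105 := by
    rw [commonNbrCount_self]
    exact hdeg (hxU ha)
  have hsum1 : ∑ z ∈ N, f z = 420 := by
    rw [hf, sum_card_filter_adj, Finset.sum_congr rfl fun a ha => hdeg (hxU ha)]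
    simp [hUcard]
  have hsum2 : ∑ z ∈ N, f z ^ 2 = 730 := by
    have h0 : ∑ z ∈ N, f z ^ 2 = ∑ a ∈ U, ∑ b ∈ U, commonNbrCount G x a b :=
      sum_sq_card_filter_adj N U
    have e (g : V → ℕ) : ∑ a ∈ U, g a = g u + (g v + (g w₁ + g w₂)) := by
      rw [hU, Finset.sum_insert hu', Finset.sum_insert hv', Finset.sum_pair hw']
    simp only [h0, e, hself hu, hself hv, hself hw₁, hself hw₂, commonNbrCount_comm x v u,
      commonNbrCount_comm x w₁ u, commonNbrCount_comm x w₂ u, commonNbrCount_comm x w₁ v,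
      commonNbrCount_comm x w₂ v, commonNbrCount_comm x w₂ w₁]
    omega
  have hfU {a : V} (ha : a ∈ U) : f a = 0 := by
    simp only [hf, Finset.card_eq_zero, Finset.filter_eq_empty_iff]
    intro b hb hab
    exact hUind a ha b hb hab.ne hab
  let g : V → ℤ := fun z => ((f z : ℤ) - 1) * (f z - 2)
  have hg0 (z : V) : 0 ≤ g z := by
    rcases Nat.lt_or_ge (f z) 2 with hz | hz
    · exact mul_nonneg_of_nonpos_of_nonpos (by omega) (by omega)
    · exact mul_nonneg (by omega) (by omega)
  have hgN : ∑ z ∈ N, g z = 10 := by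
    have e (z : V) : g z = ((f z ^ 2 : ℕ) : ℤ) - 3 * (f z : ℤ) + 2 := by
      simp only [g]
      push_cast
      ring
    simp_rw [e]
    rw [Finset.sum_add_distrib, Finset.sum_sub_distrib, ← Finset.mul_sum, ← Nat.cast_sum,
      ← Nat.cast_sum, hsum1, hsum2]
    simp [hNcard]
  have hgU : ∑ z ∈ U, g z = 8 := by
    rw [Finset.sum_congr rfl fun a ha => show g a = 2 by simp [g, hfU ha]]
    simp [hUcard]
  have hgD : ∑ z ∈ N \ U, g z = 2 := by
    have := Finset.sum_sdiff (f := g) hUN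
    omega
  obtain ⟨z, hz, hgz⟩ := Finset.exists_ne_zero_of_sum_ne_zero (hgD.trans_ne two_ne_zero)
  have hrest := Finset.add_sum_erase (N \ U) g hz
  have hrest0 : 0 ≤ ∑ w ∈ (N \ U).erase z, g w := Finset.sum_nonneg fun w _ => hg0 w
  have hfz : f z = 0 ∨ 3 ≤ f z := by
    by_contra! hc
    obtain hc | hc : f z = 1 ∨ f z = 2 := by omega
    all_goals exact hgz (by simp [g, hc])
  have hgz2 : 2 ≤ g z := by
    rcases hfz with hc | hc
    · simp [g, hc]
    · simp only [g]
      nlinarith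
  have hother : ∀ w ∈ N \ U, w ≠ z → g w = 0 := by
    intro w hw hwz
    exact (Finset.sum_eq_zero_iff_of_nonneg fun w _ => hg0 w).1 (by omega) w
      (Finset.mem_erase.2 ⟨hwz, hw⟩)
  have hother' : ∀ w ∈ N \ U, w ≠ z → 1 ≤ f w ∧ f w ≤ 2 := by
    intro w hw hwz
    rcases mul_eq_zero.1 (hother w hw hwz) with hc | hc <;> omega
  refine ⟨z, hz, ?_, fun w hw hwz => (hother' w hw hwz).2⟩
  change f z = 3
  have hgz3 : g z = 2 := by omega
  rcases hfz with hc | hc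
  · -- The five vertices of `U ∪ {z}` would be independent.
    exfalso
    rw [Finset.mem_sdiff] at hz
    have hxz : G.Adj x z := by simpa [hN] using hz.1
    have hzU : ∀ a ∈ U, ¬ G.Adj z a := by
      simpa only [hf, Finset.card_eq_zero, Finset.filter_eq_empty_iff] using hc
    have hlow : (N ∩ G.neighborFinset z).card ≤ ∑ w ∈ N ∩ G.neighborFinset z, f w := by
      rw [Finset.card_eq_sum_ones]
      refine Finset.sum_le_sum fun w hw => ?_
      rw [Finset.mem_inter, G.mem_neighborFinset z] at hw
      exact (hother' w (Finset.mem_sdiff.2 ⟨hw.1, fun hwU => hzU w hwU hw.2⟩) hw.2.ne').1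
    have hup : ∑ w ∈ N ∩ G.neighborFinset z, f w ≤ U.card * 26 := by
      rw [hf, sum_card_filter_adj]
      refine (Finset.sum_le_card_nsmul _ _ 26 fun a ha => ?_).trans_eq (smul_eq_mul _ _)
      exact hle hxz (hxU ha) (fun hza => hz.2 (hza ▸ ha)) (hzU a ha)
    rw [hdeg hxz] at hlow
    omega
  · simp only [g] at hgz3
    nlinarith
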